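/- Let ℓ ≥ 2 and 1 ≤ i ≤ ℓ. Then φ_i(x_i) is nonzero and in(φ_i(x_i)) = x_1²·x_2²⋯x_{i−1}²·x_i^{2ℓ−2i} in the pure lexicographic order. -/

import Mathlib

open MvPolynomial Finset

noncomputable section

/-- Elementary symmetric function of degree `n` of the values of `f` on the finite set `s`. -/
def esymVal {α R : Type*} [CommSemiring R] (s : Finset α) (f : α → R) (n : ℕ) : R :=
  ∑ t ∈ Finset.powersetCard n s, ∏ a ∈ t, f a

/-- The characterizing conditions for the family of Bernoulli-like polynomials `B p q`
(for `p ≥ -1`, `q ≥ 0`, `(p,q) ≠ (-1,0)`):  oddness and the (denominator-cleared)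
difference equations. -/
def BProp (B : ℤ → ℕ → Polynomial ℝ) : Prop :=
  (∀ (p : ℤ) (q : ℕ), -1 ≤ p → ¬(p = -1 ∧ q = 0) →
      (B p q).comp (-Polynomial.X) = -(B p q)) ∧
  (∀ (p q : ℕ),
      (2 * Polynomial.X + 1) * ((B p q).comp (Polynomial.X + 1) - B p q)
        = ((Polynomial.X + 1) ^ p - (-Polynomial.X) ^ p)
            * (Polynomial.X + 1) ^ q * (-Polynomial.X) ^ q) ∧
  (∀ q : ℕ, 1 ≤ q →
      (B (-1) q).comp (Polynomial.X + 1) - B (-1) q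
        = -((-Polynomial.X) * (Polynomial.X + 1)) ^ (q - 1))

/-- The polynomial ring `S = ℝ[x_1, …, x_ℓ, z]`; the variable indexed by
`Fin.castSucc i` is `x_{i+1}` and the variable indexed by `Fin.last ℓ` is `z`. -/
abbrev SS (ℓ : ℕ) := MvPolynomial (Fin (ℓ + 1)) ℝ

/-- The field of rational functions, in which the defining formulas for the `φ_j` live. -/
abbrev KK (ℓ : ℕ) := FractionRing (SS ℓ)

/-- `x_{i+1}` as a rational function. -/
def xx (ℓ : ℕ) (i : Fin ℓ) : KK ℓ := algebraMap (SS ℓ) (KK ℓ) (X i.castSucc)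

/-- `z` as a rational function. -/
def zz (ℓ : ℕ) : KK ℓ := algebraMap (SS ℓ) (KK ℓ) (X (Fin.last ℓ))

/-- `ar B_{p,q}(x, z) = z^{p+2q}·B_{p,q}(x/z)`, as a rational function; by convention
`ar B_{-1,0}(x,z) = -1/x`. -/
def arB (B : ℤ → ℕ → Polynomial ℝ) (ℓ : ℕ) (p : ℤ) (q : ℕ) (x : KK ℓ) : KK ℓ :=
  if p = -1 ∧ q = 0 then -x⁻¹
  else zz ℓ ^ (p + 2 * (q : ℤ)) *
    Polynomial.eval₂ ((algebraMap (SS ℓ) (KK ℓ)).comp (MvPolynomial.C)) (x / zz ℓ) (B p q)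

/-- `J = {x_1, …, x_{j-1}}` (as a set of indices). -/
def Jset (ℓ : ℕ) (j : Fin ℓ) : Finset (Fin ℓ) := univ.filter (· < j)

/-- The value `φ_j(x_i)` (an element of the fraction field, which is in fact
a polynomial).  Here `j` with `(j:ℕ)+1 < ℓ` encodes `φ_{j+1}`, `1 ≤ j+1 ≤ ℓ-1`,
and `j = Fin.last` encodes `φ_ℓ`. -/
def phi (B : ℤ → ℕ → Polynomial ℝ) (ℓ : ℕ) (j i : Fin ℓ) : KK ℓ :=
  if h : (j : ℕ) + 1 < ℓ then
    (xx ℓ j - xx ℓ ⟨(j : ℕ) + 1, h⟩ - zz ℓ) *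
      ∑ K1 ∈ (Jset ℓ j).powerset, ∑ K2 ∈ ((Jset ℓ j) \ K1).powerset,
        (∏ a ∈ K1, xx ℓ a) * (∏ a ∈ K2, xx ℓ a) ^ 2 * (-zz ℓ) ^ K1.card *
          ∑ n1 ∈ Finset.range 3, ∑ n2 ∈ Finset.range (ℓ - (j : ℕ) - 1),
            (-1 : KK ℓ) ^ (n1 + n2) *
              esymVal ({j, ⟨(j : ℕ) + 1, h⟩} : Finset (Fin ℓ)) (xx ℓ) n1 *
              esymVal (univ.filter (fun a : Fin ℓ => (j : ℕ) + 1 < (a : ℕ)))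
                (fun a => xx ℓ a ^ 2) n2 *
              arB B ℓ ((2 - (n1 : ℤ)) + 2 * ((ℓ : ℤ) - (j : ℤ) - 2 - (n2 : ℤ)) - 1)
                ((j : ℕ) - K1.card - K2.card) (xx ℓ i)
  else
    ∑ K1 ∈ (Jset ℓ j).powerset, ∑ K2 ∈ ((Jset ℓ j) \ K1).powerset,
      (∏ a ∈ K1, xx ℓ a) * (∏ a ∈ K2, xx ℓ a) ^ 2 * (-zz ℓ) ^ K1.card * (-(xx ℓ j)) *
        arB B ℓ (-1) ((j : ℕ) - K1.card - K2.card) (xx ℓ i)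


/-- The exponent vector of the monomial `x_1²·x_2²⋯x_{i−1}²·x_i^{2ℓ−2i}`
(with the `1`-based index `i` corresponding to `i : Fin ℓ` via `i ↦ (i:ℕ)+1`). -/
def expo (ℓ : ℕ) (i : Fin ℓ) : Fin (ℓ + 1) →₀ ℕ :=
  Finsupp.equivFunOnFinite.symm fun p =>
    if (p : ℕ) < (i : ℕ) then 2
    else if (p : ℕ) = (i : ℕ) then 2 * (ℓ - 1 - (i : ℕ)) else 0

section BernoulliDegree

/-- The forward difference of a nonconstant real polynomial has degree exactly one less. -/
theorem natDegree_comp_X_add_one_sub {b : Polynomial ℝ} (hb : b.natDegree ≠ 0) :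
    (b.comp (Polynomial.X + 1) - b).natDegree + 1 = b.natDegree ∧
      b.comp (Polynomial.X + 1) - b ≠ 0 := by
  obtain ⟨n, hn⟩ := Nat.exists_eq_succ_of_ne_zero hb
  have ht : b.comp (Polynomial.X + 1) = Polynomial.taylor 1 b := by simp [Polynomial.taylor_apply]
  have hb0 : b ≠ 0 := by rintro rfl; simp at hb
  have hlt : (b.comp (Polynomial.X + 1) - b).natDegree < b.natDegree := by
    rw [ht]
    rcases eq_or_ne (Polynomial.taylor 1 b - b) 0 with h | h
    · rw [h]; simp; omega
    · refine Polynomial.natDegree_lt_natDegree h ?_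
      have := Polynomial.degree_sub_lt_left (p := Polynomial.taylor 1 b) (q := b) (by simp)
        (by simpa using hb0) (by simp)
      simpa using this
  have hc : (b.comp (Polynomial.X + 1) - b).coeff n = (n + 1) * b.coeff (n + 1) := by
    rw [ht, Polynomial.coeff_sub, Polynomial.taylor_coeff, Polynomial.eval_eq_sum_range' (n := 2)]
    · simp [Finset.sum_range_succ, Polynomial.hasseDeriv_coeff, add_comm 1 n,
        Nat.choose_succ_self_right]
    · have := Polynomial.natDegree_hasseDeriv_le b n
      omega
  have hne : (b.comp (Polynomial.X + 1) - b).coeff n ≠ 0 := by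
    rw [hc]
    have : b.coeff (n + 1) ≠ 0 := by
      have := Polynomial.leadingCoeff_ne_zero.mpr hb0
      rwa [Polynomial.leadingCoeff, hn] at this
    positivity
  have := Polynomial.le_natDegree_of_ne_zero hne
  refine ⟨by omega, fun h => hne (by rw [h]; simp)⟩

theorem natDegree_two_mul_X_add_one : (2 * Polynomial.X + 1 : Polynomial ℝ).natDegree = 1 := by
  have : (2 * Polynomial.X + 1 : Polynomial ℝ) =
      Polynomial.C 2 * Polynomial.X + Polynomial.C 1 := by
    simp [← Polynomial.C_ofNat]
  rw [this, Polynomial.natDegree_linear two_ne_zero]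

theorem natDegree_two_mul_X_add_one_mul_diff (b : Polynomial ℝ) :
    ((2 * Polynomial.X + 1) * (b.comp (Polynomial.X + 1) - b)).natDegree = b.natDegree := by
  by_cases hb : b.natDegree = 0
  · rw [Polynomial.natDegree_eq_zero.mp hb |>.choose_spec.symm]
    simp
  · obtain ⟨h1, h2⟩ := natDegree_comp_X_add_one_sub hb
    rw [Polynomial.natDegree_mul _ h2, natDegree_two_mul_X_add_one]
    · omega
    · intro h
      have := natDegree_two_mul_X_add_one
      rw [h] at this
      simp at this

theorem BProp.natDegree_natCast_le {B : ℤ → ℕ → Polynomial ℝ} (hB : BProp B) (p q : ℕ) :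
    (B p q).natDegree ≤ p + 2 * q := by
  rw [← natDegree_two_mul_X_add_one_mul_diff, hB.2.1]
  compute_degree
  all_goals omega

theorem BProp.natDegree_neg_one_le {B : ℤ → ℕ → Polynomial ℝ} (hB : BProp B) {q : ℕ}
    (hq : 1 ≤ q) : (B (-1) q).natDegree ≤ 2 * q - 1 := by
  rw [← natDegree_two_mul_X_add_one_mul_diff, hB.2.2 q hq]
  compute_degree
  all_goals omega

theorem BProp.natDegree_le {B : ℤ → ℕ → Polynomial ℝ} (hB : BProp B) {p : ℤ} {q N : ℕ}
    (hp : -1 ≤ p) (h : ¬(p = -1 ∧ q = 0)) (hN : (N : ℤ) = p + 2 * q) :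
    (B p q).natDegree ≤ N := by
  rcases hp.eq_or_lt with rfl | hp
  · have := hB.natDegree_neg_one_le (q := q) (by omega)
    omega
  · lift p to ℕ using by omega
    have := hB.natDegree_natCast_le p q
    omega

theorem BProp.coeff_even {B : ℤ → ℕ → Polynomial ℝ} (hB : BProp B) {p : ℤ} {q n : ℕ}
    (hp : -1 ≤ p) (h : ¬(p = -1 ∧ q = 0)) (hn : Even n) : (B p q).coeff n = 0 := by
  have hX : (-Polynomial.X : Polynomial ℝ) = Polynomial.C (-1) * Polynomial.X := by simp
  have := congrArg (fun f => Polynomial.coeff f n) (hB.1 p q hp h)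
  simp only [hX, Polynomial.comp_C_mul_X_coeff, hn.neg_one_pow, Polynomial.coeff_neg] at this
  linarith

theorem BProp.coeff_odd_ne_zero {B : ℤ → ℕ → Polynomial ℝ} (hB : BProp B) {k : ℕ}
    (hk : Odd k) : (B k 0).coeff k ≠ 0 := by
  have hle := hB.natDegree_natCast_le k 0
  have hge : k ≤ (B k 0).natDegree := by
    rw [← natDegree_two_mul_X_add_one_mul_diff, hB.2.1]
    refine Polynomial.le_natDegree_of_ne_zero ?_
    have : ((Polynomial.X : Polynomial ℝ) + 1) ^ k = (Polynomial.X + Polynomial.C 1) ^ k := by simp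
    rw [pow_zero, pow_zero, mul_one, mul_one, hk.neg_pow, sub_neg_eq_add, Polynomial.coeff_add,
      this, Polynomial.coeff_X_add_C_pow]
    simp
  have hd : (B k 0).natDegree = k := by omega
  have : (B k 0).leadingCoeff ≠ 0 := by
    rw [Polynomial.leadingCoeff_ne_zero]
    intro h
    have := hk.pos
    rw [h] at hd
    simp at hd
    omega
  rwa [Polynomial.leadingCoeff, hd] at this

end BernoulliDegree

theorem zz_ne_zero (ℓ : ℕ) : zz ℓ ≠ 0 := by
  simp [zz]

theorem xx_ne_zero (ℓ : ℕ) (i : Fin ℓ) : xx ℓ i ≠ 0 := by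
  simp [xx]

/-- The homogenized polynomial as a sum of monomials. -/
theorem BProp.arB_eq_sum {B : ℤ → ℕ → Polynomial ℝ} (hB : BProp B) {ℓ : ℕ} {p : ℤ} {q N : ℕ}
    (hp : -1 ≤ p) (h : ¬(p = -1 ∧ q = 0)) (hN : (N : ℤ) = p + 2 * q) (x : KK ℓ) :
    arB B ℓ p q x = ∑ m ∈ range (N + 1),
      algebraMap (SS ℓ) (KK ℓ) (C ((B p q).coeff m)) * x ^ m * zz ℓ ^ (N - m) := by
  have hz := zz_ne_zero ℓ
  rw [arB, if_neg h, Polynomial.eval₂_eq_sum_range' _ (Nat.lt_succ_of_le (hB.natDegree_le hp h hN)),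
    ← hN, mul_sum, zpow_natCast]
  refine sum_congr rfl fun m hm => ?_
  have hm : m ≤ N := Nat.lt_succ_iff.mp (mem_range.mp hm)
  rw [← pow_sub_mul_pow (zz ℓ) hm, div_pow, RingHom.comp_apply]
  field_simp

/-- `f` is a polynomial of degree at most `n` in the variable indexed by `a`. -/
def DegLE {ℓ : ℕ} (a : Fin (ℓ + 1)) (n : ℕ) (f : KK ℓ) : Prop :=
  ∃ P : SS ℓ, algebraMap (SS ℓ) (KK ℓ) P = f ∧ degreeOf a P ≤ n

namespace DegLE

variable {ℓ : ℕ} {a : Fin (ℓ + 1)} {m n : ℕ} {f g : KK ℓ}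

theorem mono (hf : DegLE a m f) (h : m ≤ n) : DegLE a n f :=
  let ⟨P, hP, hd⟩ := hf
  ⟨P, hP, hd.trans h⟩

theorem mul (hf : DegLE a m f) (hg : DegLE a n g) : DegLE a (m + n) (f * g) := by
  obtain ⟨P, rfl, hP⟩ := hf
  obtain ⟨Q, rfl, hQ⟩ := hg
  exact ⟨P * Q, map_mul .., (degreeOf_mul_le a P Q).trans (add_le_add hP hQ)⟩

theorem add (hf : DegLE a n f) (hg : DegLE a n g) : DegLE a n (f + g) := by
  obtain ⟨P, rfl, hP⟩ := hf
  obtain ⟨Q, rfl, hQ⟩ := hg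
  exact ⟨P + Q, map_add .., (degreeOf_add_le a P Q).trans (max_le hP hQ)⟩

theorem algebraMap_C (c : ℝ) : DegLE a n (algebraMap (SS ℓ) (KK ℓ) (C c)) :=
  ⟨C c, rfl, by simp⟩

theorem one : DegLE a n (1 : KK ℓ) := by
  simpa using algebraMap_C (ℓ := ℓ) (a := a) (n := n) 1

theorem zero : DegLE a n (0 : KK ℓ) := by
  simpa using algebraMap_C (ℓ := ℓ) (a := a) (n := n) 0

theorem neg (hf : DegLE a n f) : DegLE a n (-f) := by
  obtain ⟨P, rfl, hP⟩ := hf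
  refine ⟨-P, map_neg .., ?_⟩
  rwa [degreeOf_neg]

theorem sub (hf : DegLE a n f) (hg : DegLE a n g) : DegLE a n (f - g) := by
  rw [sub_eq_add_neg]
  exact hf.add hg.neg

theorem pow (hf : DegLE a m f) (k : ℕ) : DegLE a (k * m) (f ^ k) := by
  induction k with
  | zero => simpa using one
  | succ k ih => simpa [pow_succ, Nat.succ_mul] using ih.mul hf

theorem pow_zero_deg (hf : DegLE a 0 f) (k : ℕ) : DegLE a 0 (f ^ k) := by
  simpa using hf.pow k

theorem sum {ι : Type*} {s : Finset ι} {F : ι → KK ℓ} (h : ∀ i ∈ s, DegLE a n (F i)) :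
    DegLE a n (∑ i ∈ s, F i) :=
  Finset.sum_induction F (DegLE a n) (fun _ _ => add) zero h

theorem prod {ι : Type*} {s : Finset ι} {F : ι → KK ℓ} {w : ι → ℕ}
    (h : ∀ i ∈ s, DegLE a (w i) (F i)) : DegLE a (∑ i ∈ s, w i) (∏ i ∈ s, F i) := by
  classical
  induction s using Finset.induction_on with
  | empty => simpa using one
  | insert i s hi ih =>
    rw [sum_insert hi, prod_insert hi]
    exact (h i (mem_insert_self i s)).mul (ih fun k hk => h k (mem_insert_of_mem hk))

theorem xx_self (b : Fin ℓ) : DegLE a 1 (xx ℓ b) := by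
  refine ⟨X b.castSucc, rfl, ?_⟩
  rw [degreeOf_X]
  split_ifs <;> simp

theorem xx_of_ne {a b : Fin ℓ} (h : a ≠ b) : DegLE a.castSucc n (xx ℓ b) := by
  refine ⟨X b.castSucc, rfl, ?_⟩
  rw [degreeOf_X, if_neg (by simpa using h)]
  simp

theorem zz (a : Fin ℓ) : DegLE a.castSucc n (zz ℓ) := by
  refine ⟨X (Fin.last ℓ), rfl, ?_⟩
  rw [degreeOf_X, if_neg (Fin.castSucc_lt_last a).ne]
  simp

theorem prod_xx (a : Fin ℓ) (K : Finset (Fin ℓ)) :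
    DegLE a.castSucc (if a ∈ K then 1 else 0) (∏ b ∈ K, xx ℓ b) := by
  have := prod (a := a.castSucc) (s := K) (F := xx ℓ) (w := fun b => if a = b then 1 else 0)
    fun b _ => by
      split_ifs with h
      · exact xx_self b
      · exact xx_of_ne h
  simpa using this

theorem esymVal {ι : Type*} {s : Finset ι} {F : ι → KK ℓ} (h : ∀ i ∈ s, DegLE a 0 (F i)) (k : ℕ) :
    DegLE a 0 (esymVal s F k) := by
  refine sum fun t ht => ?_
  simpa using prod (w := fun _ => 0) fun i hi => h i ((mem_powersetCard.mp ht).1 hi)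

end DegLE

/-- `f` is a polynomial all of whose monomials are lexicographically smaller than `E`. -/
def LexLT {ℓ : ℕ} (E : Fin (ℓ + 1) →₀ ℕ) (f : KK ℓ) : Prop :=
  ∃ R : SS ℓ, algebraMap (SS ℓ) (KK ℓ) R = f ∧ ∀ d ∈ R.support, toLex d < toLex E

/-- `f` is a polynomial with initial monomial `E`. -/
def LexLead {ℓ : ℕ} (E : Fin (ℓ + 1) →₀ ℕ) (f : KK ℓ) : Prop :=
  ∃ c : ℝ, c ≠ 0 ∧ LexLT E (f - algebraMap (SS ℓ) (KK ℓ) (monomial E c))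

section Lex

variable {ℓ : ℕ} {E : Fin (ℓ + 1) →₀ ℕ} {f g : KK ℓ}

theorem LexLT.add (hf : LexLT E f) (hg : LexLT E g) : LexLT E (f + g) := by
  classical
  obtain ⟨P, rfl, hP⟩ := hf
  obtain ⟨Q, rfl, hQ⟩ := hg
  refine ⟨P + Q, map_add .., fun d hd => ?_⟩
  rcases mem_union.mp (support_add hd) with h | h
  exacts [hP d h, hQ d h]

theorem LexLT.sum {ι : Type*} {s : Finset ι} {F : ι → KK ℓ} (h : ∀ i ∈ s, LexLT E (F i)) :
    LexLT E (∑ i ∈ s, F i) :=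
  Finset.sum_induction F (LexLT E) (fun _ _ => LexLT.add) ⟨0, by simp, by simp⟩ h

theorem LexLead.add (hf : LexLead E f) (hg : LexLT E g) : LexLead E (f + g) := by
  obtain ⟨c, hc, hf⟩ := hf
  refine ⟨c, hc, ?_⟩
  rw [add_sub_right_comm]
  exact hf.add hg

theorem LexLead.sum {ι : Type*} [DecidableEq ι] {s : Finset ι} {F : ι → KK ℓ} {i₀ : ι}
    (hi₀ : i₀ ∈ s) (h₀ : LexLead E (F i₀)) (h : ∀ i ∈ s, i ≠ i₀ → LexLT E (F i)) :
    LexLead E (∑ i ∈ s, F i) := by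
  rw [← add_sum_erase s F hi₀]
  exact h₀.add (LexLT.sum fun i hi => h i (mem_of_mem_erase hi) (ne_of_mem_erase hi))

theorem LexLT.of_degLE (b : Fin (ℓ + 1)) {n : ℕ} (h : ∀ a < b, DegLE a (E a) f)
    (hb : DegLE b n f) (hn : n < E b) : LexLT E f := by
  obtain ⟨P, rfl, hP⟩ := hb
  refine ⟨P, rfl, fun d hd => ?_⟩
  have hdb : d b < E b := (degreeOf_le_iff.mp hP d hd).trans_lt hn
  have hda : ∀ a < b, d a ≤ E a := fun a ha => by
    obtain ⟨Q, hQ, hdeg⟩ := h a ha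
    rw [IsFractionRing.injective (SS ℓ) (KK ℓ) hQ] at hdeg
    exact degreeOf_le_iff.mp hdeg d hd
  by_contra! hlt
  rcases hlt.eq_or_lt with heq | hlt
  · rw [toLex_inj] at heq
    exact hdb.ne (by rw [heq])
  · obtain ⟨c, hc, hlt⟩ := Finsupp.Lex.lt_iff.mp hlt
    simp only [ofLex_toLex] at hc hlt
    rcases lt_trichotomy c b with hcb | rfl | hcb
    · exact absurd (hda c hcb) hlt.not_ge
    · exact hdb.not_gt hlt
    · exact hdb.ne (hc b hcb).symm

theorem LexLead.initial (hf : LexLead E f) :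
    f ≠ 0 ∧ ∀ P : SS ℓ, algebraMap (SS ℓ) (KK ℓ) P = f →
      E ∈ P.support ∧ ∀ d ∈ P.support, toLex d ≤ toLex E := by
  classical
  obtain ⟨c, hc, R, hR, hlt⟩ := hf
  have key : ∀ P : SS ℓ, algebraMap (SS ℓ) (KK ℓ) P = f →
      E ∈ P.support ∧ ∀ d ∈ P.support, toLex d ≤ toLex E := by
    rintro P rfl
    have hP : P = R + monomial E c := by
      apply IsFractionRing.injective (SS ℓ) (KK ℓ)
      rw [map_add, hR]
      ring
    have hE : R.coeff E = 0 := notMem_support_iff.mp fun h => (hlt E h).false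
    subst hP
    refine ⟨by simp [mem_support_iff, hE, hc], fun d hd => ?_⟩
    rcases mem_union.mp (support_add hd) with h | h
    · exact (hlt d h).le
    · rw [mem_singleton.mp (support_monomial_subset h)]
  refine ⟨?_, key⟩
  rintro rfl
  simpa using (key 0 (map_zero _)).1

end Lex

section Diagonal

variable {ℓ : ℕ} (j : Fin ℓ)

theorem expo_of_lt {a : Fin ℓ} (h : a < j) : expo ℓ j a.castSucc = 2 := by
  have : (a : ℕ) < j := h
  simp [expo, this]

theorem expo_self : expo ℓ j j.castSucc = 2 * (ℓ - 1 - j) := by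
  simp [expo]

theorem mem_Jset {a : Fin ℓ} : a ∈ Jset ℓ j ↔ a < j := by
  simp [Jset]

theorem card_Jset : (Jset ℓ j).card = j := by
  have : Jset ℓ j = Iio j := by ext; simp [Jset]
  rw [this, Fin.card_Iio]

theorem algebraMap_monomial_expo (c : ℝ) :
    algebraMap (SS ℓ) (KK ℓ) (monomial (expo ℓ j) c) =
      algebraMap (SS ℓ) (KK ℓ) (C c) * (∏ a ∈ Jset ℓ j, xx ℓ a) ^ 2 *
        xx ℓ j ^ (2 * (ℓ - 1 - j)) := by
  have hE : expo ℓ j = ∑ a ∈ Jset ℓ j, Finsupp.single a.castSucc 2 +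
      Finsupp.single j.castSucc (2 * (ℓ - 1 - j)) := by
    ext p
    rw [Finsupp.add_apply, Finsupp.finsetSum_apply]
    induction p using Fin.lastCases with
    | last =>
      simp [expo, j.isLt.le.not_gt, j.isLt.ne', (Fin.castSucc_lt_last _).ne]
    | cast p =>
      simp only [Finsupp.single_apply, Fin.castSucc_inj, sum_ite_eq', mem_Jset]
      rcases lt_trichotomy p j with h | rfl | h
      · simp [expo_of_lt j h, h, h.ne']
      · simp [expo_self]
      · have h' : (j : ℕ) < p := h
        simp [expo, h.not_gt, h.ne, h'.not_gt, h'.ne']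
  have hm : monomial (expo ℓ j) c = C c * (∏ a ∈ Jset ℓ j, X a.castSucc) ^ 2 *
      X j.castSucc ^ (2 * (ℓ - 1 - j)) := by
    rw [hE, ← prod_pow]
    simp_rw [X_pow_eq_monomial]
    rw [← monomial_sum_one, mul_assoc, monomial_mul, C_mul_monomial]
    simp
  rw [hm]
  simp [xx]

theorem BProp.degLE_arB_of_lt {B : ℤ → ℕ → Polynomial ℝ} (hB : BProp B) {a : Fin ℓ} (ha : a ≠ j)
    {p : ℤ} {q : ℕ} (hp : -1 ≤ p) (h : ¬(p = -1 ∧ q = 0)) (n : ℕ) :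
    DegLE a.castSucc n (arB B ℓ p q (xx ℓ j)) := by
  have hN : ((p + 2 * q).toNat : ℤ) = p + 2 * q := Int.toNat_of_nonneg (by omega)
  rw [hB.arB_eq_sum hp h hN]
  refine DegLE.mono (m := 0) (DegLE.sum fun m _ => ?_) (Nat.zero_le n)
  exact ((DegLE.algebraMap_C (n := 0) _).mul ((DegLE.xx_of_ne ha).pow_zero_deg m)).mul
    ((DegLE.zz a).pow_zero_deg _)

theorem BProp.degLE_arB_self {B : ℤ → ℕ → Polynomial ℝ} (hB : BProp B) {p : ℤ} {q n : ℕ}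
    (hp : -1 ≤ p) (h : ¬(p = -1 ∧ q = 0))
    (hc : ∀ m, n < m → (m : ℤ) ≤ p + 2 * q → (B p q).coeff m = 0) :
    DegLE j.castSucc n (arB B ℓ p q (xx ℓ j)) := by
  have hN : ((p + 2 * q).toNat : ℤ) = p + 2 * q := Int.toNat_of_nonneg (by omega)
  rw [hB.arB_eq_sum hp h hN]
  refine DegLE.sum fun m hm => ?_
  by_cases hmn : m ≤ n
  · exact (((DegLE.algebraMap_C (n := 0) _).mul ((DegLE.xx_self j).pow m)).mul
      ((DegLE.zz j).pow_zero_deg _)).mono (by omega)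
  · rw [mem_range] at hm
    rw [hc m (by omega) (by omega)]
    simpa using DegLE.zero

/-- The leading term of the homogenization of `B_{k,0}` for odd `k`. -/
theorem BProp.exists_arB_odd {B : ℤ → ℕ → Polynomial ℝ} (hB : BProp B) (m : ℕ) :
    ∃ c : ℝ, c ≠ 0 ∧ ∃ g : KK ℓ, arB B ℓ ((2 * m + 1 : ℕ) : ℤ) 0 (xx ℓ j) =
        algebraMap (SS ℓ) (KK ℓ) (C c) * xx ℓ j ^ (2 * m + 1) + g ∧
      (∀ a ≠ j, DegLE a.castSucc 0 g) ∧ DegLE j.castSucc (2 * m) g := by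
  refine ⟨_, hB.coeff_odd_ne_zero (odd_two_mul_add_one m), ∑ k ∈ range (2 * m + 1), algebraMap (SS ℓ) (KK ℓ)
      (C ((B ((2 * m + 1 : ℕ) : ℤ) 0).coeff k)) * xx ℓ j ^ k * zz ℓ ^ (2 * m + 1 - k),
    ?_, ?_, ?_⟩
  · rw [hB.arB_eq_sum (N := 2 * m + 1) (by omega) (by omega) (by simp), sum_range_succ, add_comm]
    simp
  · intro a ha
    refine DegLE.sum fun k _ => ?_
    exact ((DegLE.algebraMap_C (n := 0) _).mul ((DegLE.xx_of_ne ha).pow_zero_deg k)).mul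
      ((DegLE.zz a).pow_zero_deg _)
  · refine DegLE.sum fun k hk => ?_
    rw [mem_range] at hk
    exact (((DegLE.algebraMap_C (n := 0) _).mul ((DegLE.xx_self j).pow k)).mul
      ((DegLE.zz j).pow_zero_deg _)).mono (by omega)

theorem degLE_coeff {a : Fin ℓ} (K1 K2 : Finset (Fin ℓ)) :
    DegLE a.castSucc ((if a ∈ K1 then 1 else 0) + 2 * (if a ∈ K2 then 1 else 0))
      ((∏ b ∈ K1, xx ℓ b) * (∏ b ∈ K2, xx ℓ b) ^ 2 * (-zz ℓ) ^ K1.card) :=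
  ((DegLE.prod_xx a K1).mul ((DegLE.prod_xx a K2).pow 2)).mul
    ((DegLE.zz a).neg.pow_zero_deg _)

/-- A double sum over pairs of disjoint subsets of `J` has initial monomial dictated by the
summand with `K_1 = ∅` and `K_2 = J`. -/
theorem LexLead.sum_disjoint_pairs {T : Finset (Fin ℓ) → Finset (Fin ℓ) → KK ℓ} {A : KK ℓ}
    (hA : ∀ a < j, DegLE a.castSucc 0 A)
    (hT : ∀ K1 ⊆ Jset ℓ j, ∀ K2 ⊆ Jset ℓ j \ K1, ∀ a < j, DegLE a.castSucc 0 (T K1 K2))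
    (hlead : LexLead (expo ℓ j) (A * ((∏ a ∈ Jset ℓ j, xx ℓ a) ^ 2 * T ∅ (Jset ℓ j)))) :
    LexLead (expo ℓ j) (A * ∑ K1 ∈ (Jset ℓ j).powerset, ∑ K2 ∈ (Jset ℓ j \ K1).powerset,
      (∏ a ∈ K1, xx ℓ a) * (∏ a ∈ K2, xx ℓ a) ^ 2 * (-zz ℓ) ^ K1.card * T K1 K2) := by
  have hlow : ∀ K1 ⊆ Jset ℓ j, ∀ K2 ⊆ Jset ℓ j \ K1, ∀ b < j, b ∉ K2 → LexLT (expo ℓ j)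
      (A * ((∏ a ∈ K1, xx ℓ a) * (∏ a ∈ K2, xx ℓ a) ^ 2 * (-zz ℓ) ^ K1.card * T K1 K2)) := by
    intro K1 h1 K2 h2 b hb hbK
    have hd := fun a (ha : a < j) => (hA a ha).mul ((degLE_coeff K1 K2).mul (hT K1 h1 K2 h2 a ha))
    refine LexLT.of_degLE b.castSucc (n := 1) (fun a ha => ?_) ((hd b hb).mono ?_) ?_
    · induction a using Fin.lastCases with
      | last => exact absurd ha (Fin.castSucc_lt_last b).not_gt
      | cast a =>
        have haj : a < j := (Fin.castSucc_lt_castSucc_iff.mp ha).trans hb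
        rw [expo_of_lt j haj]
        refine (hd a haj).mono ?_
        by_cases ha1 : a ∈ K1
        · have : a ∉ K2 := fun ha2 => (mem_sdiff.mp (h2 ha2)).2 ha1
          simp [ha1, this]
        · simp only [ha1, if_false]
          split_ifs <;> simp
    · simp only [hbK, if_false]
      split_ifs <;> simp
    · rw [expo_of_lt j hb]
      simp
  rw [mul_sum]
  refine LexLead.sum (empty_mem_powerset _) ?_ fun K1 h1 hne => ?_
  · rw [mul_sum]
    refine LexLead.sum (i₀ := Jset ℓ j) (by simp) (by simpa using hlead) fun K2 h2 hne => ?_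
    obtain ⟨b, hbJ, hb⟩ : ∃ b ∈ Jset ℓ j, b ∉ K2 := by
      by_contra! h
      exact hne (Subset.antisymm ((mem_powerset.mp h2).trans sdiff_subset) h)
    exact hlow ∅ (empty_subset _) K2 (mem_powerset.mp h2) b ((mem_Jset j).mp hbJ) hb
  · obtain ⟨b, hb⟩ := nonempty_iff_ne_empty.mpr hne
    rw [mem_powerset] at h1
    rw [mul_sum]
    refine LexLT.sum fun K2 h2 => ?_
    rw [mem_powerset] at h2
    exact hlow K1 h1 K2 h2 b ((mem_Jset j).mp (h1 hb)) fun h => (mem_sdiff.mp (h2 h)).2 hb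

theorem lexLead_phi_last {B : ℤ → ℕ → Polynomial ℝ} (hB : BProp B) (hj : ¬(j : ℕ) + 1 < ℓ) :
    LexLead (expo ℓ j) (phi B ℓ j j) := by
  have hx := xx_ne_zero ℓ j
  have hexp : ℓ - 1 - (j : ℕ) = 0 := by omega
  have := LexLead.sum_disjoint_pairs j (A := 1)
    (T := fun K1 K2 => -xx ℓ j * arB B ℓ (-1) ((j : ℕ) - K1.card - K2.card) (xx ℓ j))
    (fun _ _ => DegLE.one) ?_ ?_
  · simpa only [phi, dif_neg hj, one_mul, mul_assoc] using this
  · intro K1 _ K2 _ a ha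
    by_cases hq : (j : ℕ) - K1.card - K2.card = 0
    · have : -xx ℓ j * arB B ℓ (-1) ((j : ℕ) - K1.card - K2.card) (xx ℓ j) = 1 := by
        rw [arB, if_pos ⟨rfl, hq⟩]
        field_simp
      exact this ▸ DegLE.one
    · exact (DegLE.xx_of_ne ha.ne).neg.mul (n := 0)
        (hB.degLE_arB_of_lt j ha.ne le_rfl (fun h => hq h.2) 0)
  · refine ⟨1, one_ne_zero, 0, ?_, by simp⟩
    rw [algebraMap_monomial_expo, card_Jset, hexp, arB, if_pos (by simp)]
    field_simp
    simp

variable (h : (j : ℕ) + 1 < ℓ)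

/-- The summand of `φ_j(x_j)` for `j < ℓ` indexed by `n_1`, `n_2`, where `q` plays the role
of `k_0`. -/
def innerTerm (B : ℤ → ℕ → Polynomial ℝ) (q n1 n2 : ℕ) : KK ℓ :=
  (-1 : KK ℓ) ^ (n1 + n2) *
    esymVal ({j, ⟨(j : ℕ) + 1, h⟩} : Finset (Fin ℓ)) (xx ℓ) n1 *
    esymVal (univ.filter (fun a : Fin ℓ => (j : ℕ) + 1 < (a : ℕ))) (fun a => xx ℓ a ^ 2) n2 *
    arB B ℓ ((2 - (n1 : ℤ)) + 2 * ((ℓ : ℤ) - (j : ℤ) - 2 - (n2 : ℤ)) - 1) q (xx ℓ j)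

theorem degLE_esymVal_sq {a : Fin ℓ} (ha : a ≤ j) (n : ℕ) :
    DegLE a.castSucc 0 (esymVal (univ.filter (fun a : Fin ℓ => (j : ℕ) + 1 < (a : ℕ)))
      (fun a => xx ℓ a ^ 2) n) := by
  refine DegLE.esymVal (fun b hb => ?_) n
  have ha : (a : ℕ) ≤ j := ha
  exact (DegLE.xx_of_ne fun hab => by simp [← hab] at hb; omega).pow_zero_deg 2

theorem esymVal_zero {α R : Type*} [CommSemiring R] (s : Finset α) (f : α → R) :
    esymVal s f 0 = 1 := by
  simp [esymVal]

theorem esymVal_pair_one {α R : Type*} [CommSemiring R] [DecidableEq α] {a b : α} (hab : a ≠ b)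
    (f : α → R) : esymVal {a, b} f 1 = f a + f b := by
  rw [esymVal, powersetCard_one, sum_map]
  simp [sum_pair hab]

theorem esymVal_pair_two {α R : Type*} [CommSemiring R] [DecidableEq α] {a b : α} (hab : a ≠ b)
    (f : α → R) : esymVal {a, b} f 2 = f a * f b := by
  have : powersetCard 2 {a, b} = {{a, b}} := by
    rw [← card_pair hab, powersetCard_self]
  simp [esymVal, this, prod_pair hab]

theorem ne_succ : j ≠ ⟨(j : ℕ) + 1, h⟩ := by
  simp [Fin.ext_iff]

theorem innerTerm_special {B : ℤ → ℕ → Polynomial ℝ} {a : Fin ℓ} (ha : a ≤ j) {n2 : ℕ}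
    (hn2 : n2 + 2 + j = ℓ) : DegLE a.castSucc 0 (innerTerm j h B 0 2 n2) := by
  have hx := xx_ne_zero ℓ j
  have hne : a ≠ ⟨(j : ℕ) + 1, h⟩ := fun hab => by
    have : (a : ℕ) ≤ j := ha
    rw [hab] at this
    simp at this
  rw [innerTerm, arB, if_pos (by constructor <;> omega), esymVal_pair_two (ne_succ j h)]
  have : ∀ s e y : KK ℓ, s * (xx ℓ j * y) * e * -(xx ℓ j)⁻¹ = -(s * y * e) := by
    intro s e y
    field_simp
  rw [this]
  exact ((((DegLE.one (n := 0)).neg.pow_zero_deg _).mul (DegLE.xx_of_ne (n := 0) hne)).mul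
    (degLE_esymVal_sq j ha n2)).neg

theorem degLE_innerTerm_of_lt {B : ℤ → ℕ → Polynomial ℝ} (hB : BProp B) {a : Fin ℓ} (ha : a < j)
    {q n1 n2 : ℕ} (hn1 : n1 < 3) (hn2 : n2 < ℓ - j - 1) :
    DegLE a.castSucc 0 (innerTerm j h B q n1 n2) := by
  by_cases hs : (2 - (n1 : ℤ)) + 2 * ((ℓ : ℤ) - (j : ℤ) - 2 - (n2 : ℤ)) - 1 = -1 ∧ q = 0
  · obtain ⟨hs, rfl⟩ := hs
    obtain rfl : n1 = 2 := by omega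
    exact innerTerm_special j h ha.le (by omega)
  · refine (((DegLE.one.neg.pow_zero_deg _).mul (DegLE.esymVal (fun b hb => ?_) n1)).mul
      (degLE_esymVal_sq j ha.le n2)).mul
      (hB.degLE_arB_of_lt j ha.ne (by omega) hs 0)
    refine DegLE.xx_of_ne ?_
    have ha : (a : ℕ) < j := ha
    rintro rfl
    simp [Fin.ext_iff] at hb
    omega

theorem degLE_innerTerm_self {B : ℤ → ℕ → Polynomial ℝ} (hB : BProp B) {n1 n2 m : ℕ}
    (hm : m + 2 + j = ℓ) (hn1 : n1 < 3) (hn2 : n2 ≤ m) (hn : n1 ≠ 0 ∨ n2 ≠ 0) :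
    DegLE j.castSucc (2 * m) (innerTerm j h B 0 n1 n2) := by
  have key : ∀ {u v : ℕ}, DegLE j.castSucc u (esymVal {j, ⟨(j : ℕ) + 1, h⟩} (xx ℓ) n1) →
      DegLE j.castSucc v (arB B ℓ ((2 - (n1 : ℤ)) + 2 * ((ℓ : ℤ) - (j : ℤ) - 2 - (n2 : ℤ)) - 1) 0
        (xx ℓ j)) → u + v ≤ 2 * m → DegLE j.castSucc (2 * m) (innerTerm j h B 0 n1 n2) :=
    fun hu hv huv => ((((DegLE.one (n := 0)).neg.pow_zero_deg _).mul hu).mul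
      (degLE_esymVal_sq j le_rfl n2)).mul hv |>.mono (by omega)
  have hx' : ∀ n, DegLE j.castSucc n (xx ℓ ⟨(j : ℕ) + 1, h⟩) := fun n =>
    DegLE.xx_of_ne (ne_succ j h)
  interval_cases n1
  · refine key (u := 0) (v := 2 * m) (by rw [esymVal_zero]; exact DegLE.one)
      (hB.degLE_arB_self j ?_ ?_ fun k hk hk' => ?_) (by omega)
    all_goals push_cast at *
    all_goals omega
  · have hp : (2 - ((1 : ℕ) : ℤ)) + 2 * ((ℓ : ℤ) - (j : ℤ) - 2 - (n2 : ℤ)) - 1 =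
        ((2 * (m - n2) : ℕ) : ℤ) := by omega
    rcases Nat.eq_zero_or_pos m with rfl | hm0
    · have h0 : arB B ℓ ((2 - ((1 : ℕ) : ℤ)) + 2 * ((ℓ : ℤ) - (j : ℤ) - 2 - (n2 : ℤ)) - 1) 0
          (xx ℓ j) = 0 := by
        rw [hp, hB.arB_eq_sum (N := 0) (by omega) (by omega) (by simp)]
        simp [hB.coeff_even (p := 0) (q := 0) (n := 0)]
      rw [innerTerm, h0, mul_zero (_ * _)]
      exact DegLE.zero
    · refine key (u := 1) (v := 2 * m - 1) ?_ ?_ (by omega)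
      · rw [esymVal_pair_one (ne_succ j h)]
        exact (DegLE.xx_self j).add (hx' 1)
      · rw [hp]
        refine hB.degLE_arB_self j (by omega) (by omega) fun k hk hk' => ?_
        exact hB.coeff_even (by omega) (by omega) ⟨m, by omega⟩
  · rcases hn2.eq_or_lt with rfl | hlt
    · exact (innerTerm_special j h le_rfl hm).mono (Nat.zero_le _)
    · refine key (u := 1) (v := 2 * m - 1) ?_
        (hB.degLE_arB_self j ?_ ?_ fun k hk hk' => ?_) (by omega)
      · rw [esymVal_pair_two (ne_succ j h)]
        exact (DegLE.xx_self j).mul (hx' 0)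
      all_goals push_cast at *
      all_goals omega

theorem lexLead_phi_of_lt (h : (j : ℕ) + 1 < ℓ) {B : ℤ → ℕ → Polynomial ℝ} (hB : BProp B) :
    LexLead (expo ℓ j) (phi B ℓ j j) := by
  obtain ⟨m, hm⟩ : ∃ m, m + 2 + (j : ℕ) = ℓ := ⟨ℓ - 2 - j, by omega⟩
  have hE : ℓ - 1 - (j : ℕ) = m + 1 := by omega
  have hr : ℓ - (j : ℕ) - 1 = m + 1 := by omega
  have hx' : ∀ a ≤ j, ∀ n, DegLE a.castSucc n (xx ℓ ⟨(j : ℕ) + 1, h⟩) := fun a ha n =>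
    DegLE.xx_of_ne fun hab => by
      have : (a : ℕ) ≤ j := ha
      simp [hab] at this
  have hA : ∀ a < j, DegLE a.castSucc 0 (xx ℓ j - xx ℓ ⟨(j : ℕ) + 1, h⟩ - zz ℓ) := fun a ha =>
    ((DegLE.xx_of_ne ha.ne).sub (hx' a ha.le 0)).sub (DegLE.zz a)
  have hAj : DegLE j.castSucc 1 (xx ℓ j - xx ℓ ⟨(j : ℕ) + 1, h⟩ - zz ℓ) :=
    ((DegLE.xx_self j).sub (hx' j le_rfl 1)).sub (DegLE.zz j)
  -- a product with the squares of the variables in `J` and a factor of small degree in `x_j`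
  have hlow : ∀ f : KK ℓ, (∀ a < j, DegLE a.castSucc 0 f) → DegLE j.castSucc (2 * m + 1) f →
      LexLT (expo ℓ j) ((∏ a ∈ Jset ℓ j, xx ℓ a) ^ 2 * f) := by
    intro f hf hfj
    refine LexLT.of_degLE j.castSucc (n := 2 * m + 1) (fun a ha => ?_) ?_ ?_
    · induction a using Fin.lastCases with
      | last => exact absurd ha (Fin.castSucc_lt_last j).not_gt
      | cast a =>
        have haj : a < j := Fin.castSucc_lt_castSucc_iff.mp ha
        rw [expo_of_lt j haj]
        exact (((DegLE.prod_xx a _).pow 2).mul (hf a haj)).mono (by split_ifs <;> simp)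
    · exact (((DegLE.prod_xx j _).pow 2).mul hfj).mono (by simp [mem_Jset])
    · rw [expo_self, hE]
      omega
  have := LexLead.sum_disjoint_pairs j (A := xx ℓ j - xx ℓ ⟨(j : ℕ) + 1, h⟩ - zz ℓ)
    (T := fun K1 K2 => ∑ n1 ∈ range 3, ∑ n2 ∈ range (ℓ - (j : ℕ) - 1),
      innerTerm j h B ((j : ℕ) - K1.card - K2.card) n1 n2) hA ?_ ?_
  · simpa only [phi, dif_pos h, innerTerm] using this
  · intro K1 _ K2 _ a ha
    exact DegLE.sum fun n1 hn1 => DegLE.sum fun n2 hn2 =>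
      degLE_innerTerm_of_lt j h hB ha (mem_range.mp hn1) (mem_range.mp hn2)
  · have hq : (j : ℕ) - (∅ : Finset (Fin ℓ)).card - (Jset ℓ j).card = 0 := by
      simp [card_Jset]
    have hrest : ∀ n1 < 3, ∀ n2 < ℓ - (j : ℕ) - 1, n1 ≠ 0 ∨ n2 ≠ 0 →
        LexLT (expo ℓ j) ((xx ℓ j - xx ℓ ⟨(j : ℕ) + 1, h⟩ - zz ℓ) *
          ((∏ a ∈ Jset ℓ j, xx ℓ a) ^ 2 * innerTerm j h B 0 n1 n2)) := by
      intro n1 hn1 n2 hn2 hn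
      rw [mul_left_comm]
      exact hlow _ (fun a ha => (hA a ha).mul (degLE_innerTerm_of_lt j h hB ha hn1 hn2))
        ((hAj.mul (degLE_innerTerm_self j h hB hm hn1 (by omega) hn)).mono (by omega))
    simp only [hq, mul_sum]
    refine LexLead.sum (i₀ := 0) (by simp) (LexLead.sum (i₀ := 0) (by simp [hr]) ?_
      fun n2 hn2 hne => hrest 0 (by simp) n2 (mem_range.mp hn2) (Or.inr hne))
      fun n1 hn1 hne => LexLT.sum fun n2 hn2 =>
        hrest n1 (mem_range.mp hn1) n2 (mem_range.mp hn2) (Or.inl hne)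
    obtain ⟨c, hc, g, hg, hga, hgj⟩ := hB.exists_arB_odd j m
    have hp : (2 - ((0 : ℕ) : ℤ)) + 2 * ((ℓ : ℤ) - (j : ℤ) - 2 - ((0 : ℕ) : ℤ)) - 1 =
        ((2 * m + 1 : ℕ) : ℤ) := by omega
    have h0 : innerTerm j h B 0 0 0 =
        algebraMap (SS ℓ) (KK ℓ) (C c) * xx ℓ j ^ (2 * m + 1) + g := by
      rw [innerTerm, hp, hg, esymVal_zero, esymVal_zero]
      simp
    refine ⟨c, hc, ?_⟩
    have hsplit : (xx ℓ j - xx ℓ ⟨(j : ℕ) + 1, h⟩ - zz ℓ) *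
          ((∏ a ∈ Jset ℓ j, xx ℓ a) ^ 2 * innerTerm j h B 0 0 0) -
            algebraMap (SS ℓ) (KK ℓ) (monomial (expo ℓ j) c) =
        (∏ a ∈ Jset ℓ j, xx ℓ a) ^ 2 *
          ((-xx ℓ ⟨(j : ℕ) + 1, h⟩ - zz ℓ) *
            (algebraMap (SS ℓ) (KK ℓ) (C c) * xx ℓ j ^ (2 * m + 1)) +
          (xx ℓ j - xx ℓ ⟨(j : ℕ) + 1, h⟩ - zz ℓ) * g) := by
      rw [algebraMap_monomial_expo, hE, h0]
      ring
    rw [hsplit]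
    refine hlow _ (fun a ha => ?_) ?_
    · exact (((hx' a ha.le 0).neg.sub (DegLE.zz a)).mul ((DegLE.algebraMap_C (n := 0) c).mul
        ((DegLE.xx_of_ne ha.ne).pow_zero_deg _))).add ((hA a ha).mul (hga a ha.ne))
    · exact ((((hx' j le_rfl 0).neg.sub (DegLE.zz j)).mul ((DegLE.algebraMap_C (n := 0) c).mul
        ((DegLE.xx_self j).pow _))).mono (by omega)).add ((hAj.mul hgj).mono (by omega))

end Diagonal

/-- Let `ℓ ≥ 2` and `1 ≤ i ≤ ℓ`.  Then `φ_i(x_i)` is nonzero and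
`in(φ_i(x_i)) = x_1²·x_2²⋯x_{i−1}²·x_i^{2ℓ−2i}` in the pure lexicographic order:
this monomial occurs in `φ_i(x_i)` and every monomial of `φ_i(x_i)` is
lexicographically at most this one. -/
theorem initial_phi_diag (B : ℤ → ℕ → Polynomial ℝ) (hB : BProp B)
    (ℓ : ℕ) (hℓ : 2 ≤ ℓ) (i : Fin ℓ) :
    phi B ℓ i i ≠ 0 ∧
    ∀ P : SS ℓ, algebraMap (SS ℓ) (KK ℓ) P = phi B ℓ i i →
      expo ℓ i ∈ P.support ∧ ∀ d ∈ P.support, toLex d ≤ toLex (expo ℓ i) := by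
  by_cases h : (i : ℕ) + 1 < ℓ
  · exact (lexLead_phi_of_lt i h hB).initial
  · exact (lexLead_phi_last i hB h).initial

end
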